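/- Let N ≥ 3 be an integer. Every scale tan(π/N)/tan(kπ/N), for k an integer with 1 ≤ k < N/2, lies in the subfield ℚ(cos(2π/N)) of ℝ, and the primitive scales {tan(π/N)/tan(kπ/N) : 1 ≤ k < N/2, gcd(k, N) = 1} form a basis of ℚ(cos(2π/N)) as a vector space over ℚ. -/

import Mathlib

open Filter Topology Polynomial

/-- For `0 < x ≤ y ≤ x + 1` and `1 ≤ s ≤ 2`, the difference of inverse powers decays
quadratically. -/
lemma abs_inv_rpow_sub_inv_rpow_le {x y s : ℝ} (hx : 0 < x) (hxy : x ≤ y) (hyx : y ≤ x + 1)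
    (hs₁ : 1 ≤ s) (hs₂ : s ≤ 2) :
    |1 / x ^ s - 1 / y ^ s| ≤ 2 * (1 / x + 1 / x ^ 2) / x := by
  have hy : 0 < y := hx.trans_le hxy
  have hq0 : 0 < x / y := by positivity
  have hq1 : x / y ≤ 1 := (div_le_one hy).2 hxy
  have hfac : 1 / x ^ s - 1 / y ^ s = 1 / x ^ s * (1 - (x / y) ^ s) := by
    rw [Real.div_rpow hx.le hy.le]
    have := (Real.rpow_pos_of_pos hx s).ne'
    have := (Real.rpow_pos_of_pos hy s).ne'
    field_simp
  have hle1 : (x / y) ^ s ≤ 1 := Real.rpow_le_one hq0.le hq1 (by linarith)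
  have hge : (x / y) ^ 2 ≤ (x / y) ^ s := by
    rw [← Real.rpow_natCast]
    exact Real.rpow_le_rpow_of_exponent_ge hq0 hq1 (by simpa using hs₂)
  have hxs : 1 / x ^ s ≤ 1 / x + 1 / x ^ 2 := by
    have h1 : 0 < 1 / x := by positivity
    have h2 : 0 < 1 / x ^ 2 := by positivity
    rcases le_total x 1 with h | h
    · have : x ^ 2 ≤ x ^ s := by
        rw [← Real.rpow_natCast]
        exact Real.rpow_le_rpow_of_exponent_ge hx h (by simpa using hs₂)
      have := one_div_le_one_div_of_le (by positivity) this
      linarith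
    · have : x ≤ x ^ s := by
        simpa using Real.rpow_le_rpow_of_exponent_le h hs₁
      have := one_div_le_one_div_of_le hx this
      linarith
  have hq : 1 - (x / y) ^ 2 ≤ 2 / x := by
    have h1 : 1 - x / y ≤ 1 / x := by
      rw [one_sub_div hy.ne', div_le_div_iff₀ hy hx]
      nlinarith
    have : 2 / x = 2 * (1 / x) := by ring
    nlinarith
  have hpos : 0 < 1 / x ^ s := by positivity
  rw [hfac, abs_of_nonneg (mul_nonneg hpos.le (by linarith))]
  calc 1 / x ^ s * (1 - (x / y) ^ s) ≤ (1 / x + 1 / x ^ 2) * (2 / x) :=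
        mul_le_mul hxs (by linarith) (by linarith) (by positivity)
    _ = _ := by ring

lemma abs_inv_rpow_sub_inv_rpow_one_sub_le {a s : ℝ} (ha₀ : 0 < a) (ha₁ : a < 1) (hs₁ : 1 ≤ s)
    (hs₂ : s ≤ 2) (n : ℕ) :
    |1 / ((n : ℝ) + a) ^ s - 1 / ((n : ℝ) + 1 - a) ^ s| ≤
      2 * (1 / min a (1 - a) ^ 2 + 1 / min a (1 - a) ^ 3) * (1 / ((n : ℝ) + 1) ^ 2) := by
  set m := min a (1 - a) with hm
  have hm0 : 0 < m := lt_min ha₀ (by linarith)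
  have hma : m ≤ a := min_le_left _ _
  have hma' : m ≤ 1 - a := min_le_right _ _
  have key : ∀ x : ℝ, n + m ≤ x →
      2 * (1 / x + 1 / x ^ 2) / x ≤ 2 * (1 / m ^ 2 + 1 / m ^ 3) * (1 / ((n : ℝ) + 1) ^ 2) := by
    intro x hx
    have hn : (0 : ℝ) ≤ n := n.cast_nonneg
    have hx' : m * (n + 1) ≤ x := by nlinarith
    have hn1 : (1 : ℝ) ≤ n + 1 := by linarith
    have hmn : 0 < m * ((n : ℝ) + 1) := by positivity
    have hx0 : 0 < x := by linarith
    have h1 : 1 / x ≤ 1 / (m * (n + 1)) := one_div_le_one_div_of_le hmn hx'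
    have h2 : 1 / (m * ((n : ℝ) + 1)) ≤ 1 / m := one_div_le_one_div_of_le hm0 (by nlinarith)
    have h3 : 0 < 1 / x := by positivity
    calc 2 * (1 / x + 1 / x ^ 2) / x = 2 * ((1 / x) ^ 2 * (1 + 1 / x)) := by field_simp
      _ ≤ 2 * ((1 / (m * (n + 1))) ^ 2 * (1 + 1 / m)) := by gcongr; linarith
      _ = _ := by field_simp
  rcases le_total ((n : ℝ) + a) (n + 1 - a) with h | h
  · exact (abs_inv_rpow_sub_inv_rpow_le (by positivity) h (by linarith) hs₁ hs₂).trans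
      (key _ (by linarith))
  · rw [abs_sub_comm]
    exact (abs_inv_rpow_sub_inv_rpow_le (by have := n.cast_nonneg (α := ℝ); linarith) h
      (by linarith) hs₁ hs₂).trans (key _ (by linarith))

lemma summable_one_div_nat_add_one_sq : Summable fun n : ℕ ↦ 1 / ((n : ℝ) + 1) ^ 2 := by
  have := (summable_nat_add_iff 1).2 (Real.summable_one_div_nat_pow.2 one_lt_two)
  simpa using this

/-- Mittag-Leffler expansion of the cotangent, with the terms paired as in the odd Hurwitz zeta
function. -/
lemma tsum_one_div_add_sub_one_div_eq_cot {a : ℝ} (ha₀ : 0 < a) (ha₁ : a < 1) :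
    ∑' n : ℕ, (1 / ((n : ℂ) + a) - 1 / ((n : ℂ) + 1 - a)) =
      Real.pi * Complex.cot (Real.pi * a) := by
  have hz : (a : ℂ) ∈ Complex.integerComplement := by
    rintro ⟨m, hm⟩
    have hm' : (m : ℝ) = a := by exact_mod_cast hm
    rw [← hm'] at ha₀ ha₁
    have h0 : 0 < m := by exact_mod_cast ha₀
    have h1 : m < 1 := by exact_mod_cast ha₁
    omega
  have hsum : Summable fun n : ℕ ↦ (1 / ((n : ℂ) + a) - 1 / ((n : ℂ) + 1 - a)) := by
    refine Summable.of_norm_bounded (summable_one_div_nat_add_one_sq.mul_left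
      (2 * (1 / min a (1 - a) ^ 2 + 1 / min a (1 - a) ^ 3))) fun n ↦ ?_
    have := abs_inv_rpow_sub_inv_rpow_one_sub_le ha₀ ha₁ le_rfl one_le_two n
    rw [Real.rpow_one, Real.rpow_one] at this
    refine le_trans (le_of_eq ?_) this
    rw [← Real.norm_eq_abs, ← Complex.norm_real]
    push_cast
    rfl
  have h1 := hsum.hasSum.tendsto_sum_nat
  have h2 := (summable_cotTerm hz).hasSum.tendsto_sum_nat
  have hpart : ∀ M : ℕ, ∑ n ∈ Finset.range M, (1 / ((n : ℂ) + a) - 1 / ((n : ℂ) + 1 - a)) =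
      1 / (a : ℂ) + ∑ n ∈ Finset.range M, cotTerm a n - 1 / ((M : ℂ) + a) := by
    intro M
    induction M with
    | zero => simp
    | succ M ih =>
      rw [Finset.sum_range_succ, Finset.sum_range_succ, ih, cotTerm]
      have : (a : ℂ) - (M + 1) = -(M + 1 - a) := by ring
      rw [this, div_neg]
      push_cast
      rw [show (a : ℂ) + (M + 1) = M + 1 + a by ring]
      ring
  have h3 : Tendsto (fun M : ℕ ↦ 1 / ((M : ℂ) + a)) atTop (𝓝 0) := by
    have : Tendsto (fun M : ℕ ↦ 1 / ((M : ℝ) + a)) atTop (𝓝 0) :=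
      tendsto_const_nhds.div_atTop (tendsto_atTop_add_const_right _ _ tendsto_natCast_atTop_atTop)
    have := (Complex.continuous_ofReal.tendsto 0).comp this
    simpa [Function.comp_def] using this
  have h4 := (h2.const_add (1 / (a : ℂ))).sub h3
  simp_rw [← hpart] at h4
  rw [tendsto_nhds_unique h1 h4]
  have := cot_series_rep' hz
  simp only [cotTerm]
  rw [← this]
  ring

/-- The value at `s = 1` of the odd Hurwitz zeta function. -/
theorem hurwitzZetaOdd_one {a : ℝ} (ha₀ : 0 < a) (ha₁ : a < 1) :
    HurwitzZeta.hurwitzZetaOdd a 1 = Real.pi / 2 * Complex.cot (Real.pi * a) := by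
  let f : ℝ → ℕ → ℂ := fun s n ↦ (1 / (n + a : ℂ) ^ (s : ℂ) - 1 / (n + 1 - a : ℂ) ^ (s : ℂ)) / 2
  have hreal : ∀ (s : ℝ) (n : ℕ), f s n =
      (((1 / ((n : ℝ) + a) ^ s - 1 / ((n : ℝ) + 1 - a) ^ s) / 2 : ℝ) : ℂ) := by
    intro s n
    have h1 : (0 : ℝ) ≤ n + a := by positivity
    have h2 : (0 : ℝ) ≤ n + 1 - a := by have := n.cast_nonneg (α := ℝ); linarith
    simp only [f, Complex.ofReal_div, Complex.ofReal_sub, Complex.ofReal_one,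
      Complex.ofReal_cpow h1, Complex.ofReal_cpow h2]
    push_cast
    rfl
  have hlim : Tendsto (fun s ↦ ∑' n, f s n) (𝓝[>] (1 : ℝ)) (𝓝 (∑' n, f 1 n)) := by
    refine tendsto_tsum_of_dominated_convergence (summable_one_div_nat_add_one_sq.mul_left
      (2 * (1 / min a (1 - a) ^ 2 + 1 / min a (1 - a) ^ 3))) (fun n ↦ ?_) ?_
    · refine Tendsto.mono_left ?_ nhdsWithin_le_nhds
      have h1 : (n : ℂ) + a ≠ 0 := by
        have : (n : ℝ) + a ≠ 0 := by positivity
        exact_mod_cast this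
      have h2 : (n : ℂ) + 1 - a ≠ 0 := by
        have : (n : ℝ) + 1 - a ≠ 0 := by have := n.cast_nonneg (α := ℝ); linarith
        exact_mod_cast this
      have hc : Continuous fun s : ℝ ↦ f s n := by
        refine Continuous.div_const (Continuous.sub ?_ ?_) _
        · exact continuous_const.div (Complex.continuous_ofReal.const_cpow (.inl h1))
            fun s ↦ by simp [Complex.cpow_eq_zero_iff, h1]
        · exact continuous_const.div (Complex.continuous_ofReal.const_cpow (.inl h2))
            fun s ↦ by simp [Complex.cpow_eq_zero_iff, h2]
      exact hc.tendsto 1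
    · have : ∀ᶠ s : ℝ in 𝓝[>] 1, s ∈ Set.Ioo (1 : ℝ) 2 := Ioo_mem_nhdsGT one_lt_two
      filter_upwards [this] with s hs n
      rw [hreal, Complex.norm_real, Real.norm_eq_abs, abs_div, abs_two]
      have := abs_inv_rpow_sub_inv_rpow_one_sub_le ha₀ ha₁ hs.1.le hs.2.le n
      refine le_trans (half_le_self (abs_nonneg _)) this
  have hlim' : Tendsto (fun s : ℝ ↦ HurwitzZeta.hurwitzZetaOdd a s) (𝓝[>] (1 : ℝ))
      (𝓝 (HurwitzZeta.hurwitzZetaOdd a 1)) := by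
    have hc := (HurwitzZeta.differentiable_hurwitzZetaOdd a).continuous.comp
      Complex.continuous_ofReal
    simpa [Function.comp_def] using (hc.tendsto 1).mono_left nhdsWithin_le_nhds
  have heq : (fun s : ℝ ↦ HurwitzZeta.hurwitzZetaOdd a s) =ᶠ[𝓝[>] (1 : ℝ)]
      fun s ↦ ∑' n, f s n := by
    filter_upwards [self_mem_nhdsWithin] with s hs
    exact (HurwitzZeta.hasSum_nat_hurwitzZetaOdd_of_mem_Icc ⟨ha₀.le, ha₁.le⟩
      (by simpa using hs)).tsum_eq.symm
  rw [tendsto_nhds_unique (hlim'.congr' heq) hlim]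
  simp only [f, Complex.ofReal_one, Complex.cpow_one, tsum_div_const,
    tsum_one_div_add_sub_one_div_eq_cot ha₀ ha₁]
  ring

/-- Up to a nonzero factor, the sum is `L(1, χ)`. -/
theorem sum_odd_char_mul_cot_ne_zero {N : ℕ} [NeZero N] (hN : 1 < N) {χ : DirichletCharacter ℂ N}
    (hχ : χ.Odd) : ∑ j : ZMod N, χ j * Complex.cot (Real.pi * (j.val / N)) ≠ 0 := by
  intro h0
  have hχ1 : χ ≠ 1 := by
    rintro rfl
    have h : (1 : DirichletCharacter ℂ N) (-1) = -1 := hχ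
    rw [MulChar.one_apply isUnit_one.neg] at h
    norm_num at h
  refine DirichletCharacter.LFunction_apply_one_ne_zero hχ1 ?_
  have : Fact (1 < N) := ⟨hN⟩
  rw [DirichletCharacter.LFunction, ZMod.LFunction_def_odd hχ.to_fun]
  have : ∀ j : ZMod N, χ j * HurwitzZeta.hurwitzZetaOdd (ZMod.toAddCircle j) 1 =
      Real.pi / 2 * (χ j * Complex.cot (Real.pi * (j.val / N))) := by
    intro j
    rcases eq_or_ne j 0 with rfl | hj
    · simp [MulChar.map_zero χ]
    · have hN0 : (0 : ℝ) < N := by positivity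
      have hv : 0 < j.val := (ZMod.val_pos).2 hj
      rw [ZMod.toAddCircle_apply, hurwitzZetaOdd_one (by positivity)
        ((div_lt_one hN0).2 (by exact_mod_cast ZMod.val_lt j))]
      push_cast
      ring
  simp_rw [this, ← Finset.mul_sum, h0, mul_zero]

/-- A rational polynomial whose value at `exp(2πik/N)` is `i cot(πk/N)`. -/
noncomputable def cotPolynomial (N : ℕ) : ℚ[X] :=
  ∑ j ∈ Finset.range N, C (1 - 2 * (j : ℚ) / N) * X ^ j - 1

lemma sum_range_natCast_mul_pow_mul_sub_one (z : ℂ) (n : ℕ) :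
    (∑ j ∈ Finset.range n, (j : ℂ) * z ^ j) * (z - 1) =
      n * z ^ n - ∑ j ∈ Finset.range n, z ^ (j + 1) := by
  induction n with
  | zero => simp
  | succ n ih =>
    rw [Finset.sum_range_succ, add_mul, ih, Finset.sum_range_succ]
    push_cast
    ring

lemma aeval_cotPolynomial_mul_sub_one {N : ℕ} (hN : N ≠ 0) {z : ℂ} (hz : z ^ N = 1) (hz1 : z ≠ 1) :
    aeval z (cotPolynomial N) * (z - 1) = -(z + 1) := by
  have hN' : (N : ℂ) ≠ 0 := by exact_mod_cast hN
  have hg : ∑ j ∈ Finset.range N, z ^ j = 0 := by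
    have := geom_sum_mul z N
    rw [hz, sub_self] at this
    exact (mul_eq_zero.1 this).resolve_right (sub_ne_zero.2 hz1)
  have hs := sum_range_natCast_mul_pow_mul_sub_one z N
  simp_rw [pow_succ, ← Finset.sum_mul, hg, hz] at hs
  have he : aeval z (cotPolynomial N) =
      ∑ j ∈ Finset.range N, z ^ j - 2 / N * (∑ j ∈ Finset.range N, (j : ℂ) * z ^ j) - 1 := by
    simp only [cotPolynomial, map_sub, map_sum, map_mul, aeval_C, map_pow, aeval_X, map_one,
      Finset.mul_sum, ← Finset.sum_sub_distrib]
    congr 1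
    refine Finset.sum_congr rfl fun j _ ↦ ?_
    simp
    ring
  rw [he, hg, sub_mul, sub_mul, mul_assoc, hs]
  field_simp
  ring

lemma aeval_cotPolynomial_one {N : ℕ} (hN : N ≠ 0) : aeval (1 : ℂ) (cotPolynomial N) = 0 := by
  have hN' : (N : ℚ) ≠ 0 := by exact_mod_cast hN
  have h : ∀ n : ℕ, ∑ j ∈ Finset.range n, (1 - 2 * (j : ℚ) / N) = n - n * (n - 1) / N := by
    intro n
    induction n with
    | zero => simp
    | succ n ih =>
      rw [Finset.sum_range_succ, ih]
      push_cast
      ring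
  have h1 : eval 1 (cotPolynomial N) = 0 := by
    simp only [cotPolynomial, eval_sub, eval_finsetSum, eval_mul, eval_C, eval_pow, eval_X,
      one_pow, mul_one, eval_one, h]
    field_simp
    ring
  have := aeval_algebraMap_apply ℂ (1 : ℚ) (cotPolynomial N)
  rw [map_one] at this
  rw [this, coe_aeval_eq_eval, h1, map_zero]

lemma aeval_cotPolynomial_exp_pow {N : ℕ} (hN : N ≠ 0) (k : ℕ) :
    aeval (Complex.exp (2 * Real.pi * Complex.I / N) ^ k) (cotPolynomial N) =
      Complex.I * Complex.cot (Real.pi * (k / N)) := by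
  have hN' : (N : ℂ) ≠ 0 := by exact_mod_cast hN
  have hprim := Complex.isPrimitiveRoot_exp N hN
  set ζ := Complex.exp (2 * Real.pi * Complex.I / N) with hζ
  have hcot : Complex.cot (Real.pi * (k / N)) = (ζ ^ k + 1) / (Complex.I * (1 - ζ ^ k)) := by
    have he : Complex.exp (2 * Complex.I * (Real.pi * (k / N))) = ζ ^ k := by
      rw [hζ, ← Complex.exp_nat_mul]
      congr 1
      ring
    rw [Complex.cot_eq_exp_ratio, he]
  rcases eq_or_ne (ζ ^ k) 1 with h | h
  · rw [h, aeval_cotPolynomial_one hN, hcot, h]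
    simp
  · have h1 := aeval_cotPolynomial_mul_sub_one hN
      (by rw [← pow_mul, mul_comm, pow_mul, hprim.pow_eq_one, one_pow]) h
    have h2 : ζ ^ k - 1 ≠ 0 := sub_ne_zero.2 h
    have h3 : 1 - ζ ^ k ≠ 0 := sub_ne_zero.2 h.symm
    rw [hcot, eq_div_of_mul_eq h2 h1]
    field_simp
    ring

/-- Rational linear relations between the `cot(πk/N)` are stable under Galois conjugation. -/
theorem sum_mul_cot_mul_eq_zero {N : ℕ} (hN : N ≠ 0) (s : Finset ℕ) (a : ℕ → ℚ)
    (h : ∑ k ∈ s, (a k : ℂ) * Complex.cot (Real.pi * (k / N)) = 0) {m : ℕ} (hm : m.Coprime N) :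
    ∑ k ∈ s, (a k : ℂ) * Complex.cot (Real.pi * ((k * m : ℕ) / N)) = 0 := by
  have hprim := Complex.isPrimitiveRoot_exp N hN
  set ζ := Complex.exp (2 * Real.pi * Complex.I / N) with hζ
  let P : ℚ[X] := ∑ k ∈ s, C (a k) * (cotPolynomial N).comp (X ^ k)
  have hP : ∀ m : ℕ, aeval (ζ ^ m) P =
      Complex.I * ∑ k ∈ s, (a k : ℂ) * Complex.cot (Real.pi * ((k * m : ℕ) / N)) := by
    intro m
    simp only [P, map_sum, map_mul, aeval_C, aeval_comp, map_pow, aeval_X, Finset.mul_sum]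
    refine Finset.sum_congr rfl fun k _ ↦ ?_
    rw [← pow_mul, mul_comm m k, hζ, aeval_cotPolynomial_exp_pow hN]
    simp
    ring
  have h1 : aeval ζ P = 0 := by
    have := hP 1
    simp only [mul_one, pow_one, h, mul_zero] at this
    exact this
  have hdvd : cyclotomic N ℚ ∣ P := by
    rw [cyclotomic_eq_minpoly_rat hprim (Nat.pos_of_ne_zero hN)]
    exact minpoly.dvd _ _ h1
  have hm0 : aeval (ζ ^ m) P = 0 := by
    refine aeval_eq_zero_of_dvd_aeval_eq_zero hdvd ?_
    rw [cyclotomic_eq_minpoly_rat (hprim.pow_of_coprime m hm) (Nat.pos_of_ne_zero hN)]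
    exact minpoly.aeval _ _
  rw [hP] at hm0
  exact (mul_eq_zero.1 hm0).resolve_left Complex.I_ne_zero

lemma cot_pi_mul_val_div {N : ℕ} [NeZero N] (n : ℕ) :
    Complex.cot (Real.pi * ((n : ZMod N).val / N)) = Complex.cot (Real.pi * (n / N)) := by
  have hN : N ≠ 0 := NeZero.ne N
  have hprim := Complex.isPrimitiveRoot_exp N hN
  have h : Complex.exp (2 * Real.pi * Complex.I / N) ^ (n : ZMod N).val =
      Complex.exp (2 * Real.pi * Complex.I / N) ^ n := by
    rw [ZMod.val_natCast, ← pow_mod_orderOf _ n, ← hprim.eq_orderOf]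
  have := aeval_cotPolynomial_exp_pow hN n
  rw [← h, aeval_cotPolynomial_exp_pow hN] at this
  exact mul_left_cancel₀ Complex.I_ne_zero this

lemma sum_mul_odd_char_eq_zero {N : ℕ} [NeZero N] (hN : 1 < N) {s : Finset ℕ}
    (hs : ∀ k ∈ s, k.Coprime N) {a : ℕ → ℚ}
    (h : ∑ k ∈ s, (a k : ℂ) * Complex.cot (Real.pi * (k / N)) = 0)
    {χ : DirichletCharacter ℂ N} (hχ : χ.Odd) : ∑ k ∈ s, (a k : ℂ) * χ k = 0 := by
  set c : ZMod N → ℂ := fun j ↦ Complex.cot (Real.pi * (j.val / N)) with hc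
  have hψ : (χ⁻¹).Odd := by
    change χ⁻¹ (-1) = -1
    rw [MulChar.inv_apply_eq_inv', show χ (-1) = -1 from hχ]
    norm_num
  have hzero : ∀ m : ZMod N, χ⁻¹ m * ∑ k ∈ s, (a k : ℂ) * c (k * m) = 0 := by
    intro m
    by_cases hm : IsUnit m
    · have hm' : m.val.Coprime N := by
        rwa [← ZMod.isUnit_iff_coprime, ZMod.natCast_zmod_val]
      have := sum_mul_cot_mul_eq_zero (NeZero.ne N) s a h hm'
      rw [mul_eq_zero]
      right
      rw [← this]
      refine Finset.sum_congr rfl fun k _ ↦ ?_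
      rw [← cot_pi_mul_val_div (N := N)]
      simp [hc]
    · rw [MulChar.map_nonunit _ hm, zero_mul]
  have hswap : ∀ k ∈ s, ∑ m : ZMod N, χ⁻¹ m * c (k * m) = χ k * ∑ m : ZMod N, χ⁻¹ m * c m := by
    intro k hk
    obtain ⟨u, hu⟩ := (ZMod.isUnit_iff_coprime k N).2 (hs k hk)
    rw [Finset.mul_sum]
    refine Fintype.sum_equiv u.mulLeft _ _ fun m ↦ ?_
    rw [Units.mulLeft_apply, hu, map_mul, ← mul_assoc, ← mul_assoc, ← MulChar.mul_apply,
      mul_inv_cancel, MulChar.one_apply (hu ▸ u.isUnit), one_mul]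
  have hprod : (∑ k ∈ s, (a k : ℂ) * χ k) * ∑ m : ZMod N, χ⁻¹ m * c m = 0 := by
    calc (∑ k ∈ s, (a k : ℂ) * χ k) * ∑ m : ZMod N, χ⁻¹ m * c m
        = ∑ k ∈ s, ∑ m : ZMod N, χ⁻¹ m * ((a k : ℂ) * c (k * m)) := by
          rw [Finset.sum_mul]
          refine Finset.sum_congr rfl fun k hk ↦ ?_
          rw [mul_assoc, ← hswap k hk, Finset.mul_sum]
          exact Finset.sum_congr rfl fun m _ ↦ by ring
      _ = 0 := by
          rw [Finset.sum_comm]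
          refine Finset.sum_eq_zero fun m _ ↦ ?_
          rw [← Finset.mul_sum, hzero]
  exact (mul_eq_zero.1 hprod).resolve_right (sum_odd_char_mul_cot_ne_zero hN hψ)

/-- The `cot(πk/N)` with `k < N/2` prime to `N` are linearly independent over `ℚ`. -/
theorem coeff_eq_zero_of_sum_mul_cot_eq_zero {N : ℕ} [NeZero N] (hN : 1 < N) {s : Finset ℕ}
    (hs : ∀ k ∈ s, 2 * k < N ∧ k.Coprime N) {a : ℕ → ℚ}
    (h : ∑ k ∈ s, (a k : ℂ) * Complex.cot (Real.pi * (k / N)) = 0) {l : ℕ} (hl : l ∈ s) :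
    a l = 0 := by
  have hunit : IsUnit (l : ZMod N) := (ZMod.isUnit_iff_coprime l N).2 (hs l hl).2
  have hneg : ∀ k ∈ s, (l : ZMod N) ≠ -(k : ZMod N) := by
    intro k hk heq
    have hlk : ((l + k : ℕ) : ZMod N) = 0 := by
      rw [Nat.cast_add, heq, neg_add_cancel]
    have hl0 : l ≠ 0 := by
      rintro rfl
      have := (hs 0 hl).2
      rw [Nat.coprime_zero_left] at this
      omega
    have := Nat.le_of_dvd (by omega) ((ZMod.natCast_eq_zero_iff _ _).1 hlk)
    have := (hs l hl).1
    have := (hs k hk).1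
    omega
  have hzero : ∀ χ : DirichletCharacter ℂ N,
      χ (l : ZMod N)⁻¹ * (1 - χ (-1)) * ∑ k ∈ s, (a k : ℂ) * χ k = 0 := by
    intro χ
    rcases χ.even_or_odd with hχ | hχ
    · rw [show χ (-1) = 1 from hχ, sub_self, mul_zero, zero_mul]
    · rw [sum_mul_odd_char_eq_zero hN (fun k hk ↦ (hs k hk).2) h hχ, mul_zero]
  have hsum : ∑ k ∈ s, (a k : ℂ) * (∑ χ : DirichletCharacter ℂ N, χ (l : ZMod N)⁻¹ * χ k -
      ∑ χ : DirichletCharacter ℂ N, χ (l : ZMod N)⁻¹ * χ (-k)) = 0 := by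
    rw [← Finset.sum_eq_zero (fun χ (_ : χ ∈ Finset.univ) ↦ hzero χ)]
    simp_rw [Finset.mul_sum, ← Finset.sum_sub_distrib]
    simp_rw [Finset.mul_sum]
    rw [Finset.sum_comm]
    refine Finset.sum_congr rfl fun χ _ ↦ Finset.sum_congr rfl fun k _ ↦ ?_
    rw [← neg_one_mul (k : ZMod N), map_mul]
    ring
  simp_rw [DirichletCharacter.sum_char_inv_mul_char_eq ℂ hunit] at hsum
  rw [Finset.sum_eq_single_of_mem l hl] at hsum
  · have hφ : (N.totient : ℂ) ≠ 0 := by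
      exact_mod_cast (Nat.totient_pos.2 (NeZero.pos N)).ne'
    rw [if_pos rfl, if_neg (hneg l hl), sub_zero] at hsum
    exact_mod_cast (mul_eq_zero.1 hsum).resolve_right hφ
  · intro k hk hkl
    rw [if_neg, if_neg]
    · simp
    · exact hneg k hk
    · intro heq
      rw [ZMod.natCast_eq_natCast_iff', Nat.mod_eq_of_lt (by have := (hs l hl).1; omega),
        Nat.mod_eq_of_lt (by have := (hs k hk).1; omega)] at heq
      exact hkl heq.symm

lemma cos_pos_of_two_mul_lt {N k : ℕ} (hN : 2 * k < N) :
    0 < Real.cos (k * Real.pi / N) := by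
  have hN0 : (0 : ℝ) < N := by exact_mod_cast (by omega : 0 < N)
  have hk : (2 * k : ℝ) < N := by exact_mod_cast hN
  apply Real.cos_pos_of_mem_Ioo
  constructor
  · have : 0 ≤ k * Real.pi / N := by positivity
    linarith [Real.pi_pos]
  · rw [div_lt_div_iff₀ hN0 two_pos]
    nlinarith [Real.pi_pos]

lemma sin_pos_of_two_mul_lt {N k : ℕ} (hk : 1 ≤ k) (hN : 2 * k < N) :
    0 < Real.sin (k * Real.pi / N) := by
  have hN0 : (0 : ℝ) < N := by exact_mod_cast (by omega : 0 < N)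
  have hk0 : (0 : ℝ) < k := by exact_mod_cast hk
  have hk : (2 * k : ℝ) < N := by exact_mod_cast hN
  apply Real.sin_pos_of_pos_of_lt_pi
  · positivity
  · rw [div_lt_iff₀ hN0]
    nlinarith [Real.pi_pos]

/-- Inverse scales lie in `ℚ(cos(2π/N))`, by induction via the addition formula for `tan`. -/
lemma tan_div_tan_mem {N : ℕ} (hN : 3 ≤ N) {k : ℕ} (hk : 2 * k < N) :
    Real.tan (k * Real.pi / N) / Real.tan (Real.pi / N) ∈
      IntermediateField.adjoin ℚ {Real.cos (2 * Real.pi / N)} := by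
  set F := IntermediateField.adjoin ℚ {Real.cos (2 * Real.pi / N)}
  have hcos : 0 < Real.cos (Real.pi / N) := by
    simpa using cos_pos_of_two_mul_lt (N := N) (k := 1) (by omega)
  have hsin : 0 < Real.sin (Real.pi / N) := by
    simpa using sin_pos_of_two_mul_lt (N := N) (k := 1) le_rfl (by omega)
  have htan : Real.tan (Real.pi / N) ^ 2 ∈ F := by
    have hc : Real.cos (2 * Real.pi / N) ∈ F := IntermediateField.mem_adjoin_simple_self ℚ _
    have h2 : Real.cos (2 * Real.pi / N) = 2 * Real.cos (Real.pi / N) ^ 2 - 1 := by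
      rw [← Real.cos_two_mul]
      congr 1
      ring
    have : Real.tan (Real.pi / N) ^ 2 =
        (1 - Real.cos (2 * Real.pi / N)) / (1 + Real.cos (2 * Real.pi / N)) := by
      rw [Real.tan_eq_sin_div_cos, h2, div_pow, Real.sin_sq, add_sub_cancel]
      field_simp
      ring
    rw [this]
    exact F.div_mem (F.sub_mem F.one_mem hc) (F.add_mem F.one_mem hc)
  induction k with
  | zero => simp
  | succ k ih =>
    have ht := ih (by omega)
    have hadd : ((k + 1 : ℕ) : ℝ) * Real.pi / N = k * Real.pi / N + Real.pi / N := by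
      push_cast
      ring
    have hck := cos_pos_of_two_mul_lt (N := N) (k := k) (by omega)
    have hck' := cos_pos_of_two_mul_lt hk
    set x := Real.pi / N
    set y := (k : ℝ) * Real.pi / N
    have htx : Real.tan x ≠ 0 := by
      rw [Real.tan_eq_sin_div_cos]
      positivity
    have : Real.tan (((k + 1 : ℕ) : ℝ) * Real.pi / N) / Real.tan x =
        (Real.tan y / Real.tan x + 1) / (1 - Real.tan y / Real.tan x * Real.tan x ^ 2) := by
      have hden : 1 - Real.tan y / Real.tan x * Real.tan x ^ 2 =
          Real.cos (y + x) / (Real.cos y * Real.cos x) := by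
        rw [div_mul_eq_mul_div, pow_two, ← mul_assoc, mul_div_cancel_right₀ _ htx,
          Real.tan_eq_sin_div_cos, Real.tan_eq_sin_div_cos, Real.cos_add]
        field_simp
      rw [hadd] at hck' ⊢
      rw [hden, Real.tan_eq_sin_div_cos (y + x), Real.sin_add, Real.tan_eq_sin_div_cos,
        Real.tan_eq_sin_div_cos]
      field_simp
    rw [this]
    exact F.div_mem (F.add_mem ht F.one_mem) (F.sub_mem F.one_mem (F.mul_mem ht htan))

/-- `ℚ(cos(2π/N))` has degree at most `φ(N)/2`: with `F` this field, `F ⊕ F · i sin(2π/N)` embeds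
in `ℚ(ζ_N)`. -/
lemma two_mul_finrank_adjoin_cos_le {N : ℕ} (hN : 3 ≤ N) :
    FiniteDimensional ℚ (IntermediateField.adjoin ℚ {Real.cos (2 * Real.pi / N)}) ∧
    2 * Module.finrank ℚ (IntermediateField.adjoin ℚ {Real.cos (2 * Real.pi / N)}) ≤
      N.totient := by
  set θ := 2 * Real.pi / N with hθ
  set F := IntermediateField.adjoin ℚ {Real.cos θ} with hF
  have hprim := Complex.isPrimitiveRoot_exp N (by omega)
  set ζ := Complex.exp (2 * Real.pi * Complex.I / N) with hζ
  have hζθ : ζ = Complex.exp (θ * Complex.I) := by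
    rw [hζ, hθ]
    congr 1
    push_cast
    ring
  let K := IntermediateField.adjoin ℚ {ζ}
  have hint : IsIntegral ℚ ζ := hprim.isIntegral (by omega) |>.tower_top
  have hKfin : FiniteDimensional ℚ K := IntermediateField.adjoin.finiteDimensional hint
  have hKrank : Module.finrank ℚ K = N.totient := by
    rw [IntermediateField.adjoin.finrank hint, ← cyclotomic_eq_minpoly_rat hprim (by omega),
      natDegree_cyclotomic]
  have hζK : ζ ∈ K := IntermediateField.mem_adjoin_simple_self ℚ ζ
  have hcosK : (Real.cos θ : ℂ) ∈ K := by
    rw [Complex.ofReal_cos, Complex.cos, neg_mul, Complex.exp_neg, ← hζθ]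
    exact K.div_mem (K.add_mem hζK (K.inv_mem hζK)) (ofNat_mem K 2)
  have hsin : Real.sin θ ≠ 0 := by
    have := Real.sin_pos_of_pos_of_lt_pi (x := θ) (by positivity) (by
      rw [hθ, div_lt_iff₀ (by positivity)]
      have : (3 : ℝ) ≤ N := by exact_mod_cast hN
      nlinarith [Real.pi_pos])
    exact this.ne'
  have hsinK : Real.sin θ * Complex.I ∈ K := by
    have : Real.sin θ * Complex.I = ζ - Real.cos θ := by
      rw [hζθ, Complex.exp_mul_I]
      push_cast
      ring
    rw [this]
    exact K.sub_mem hζK hcosK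
  have hFK : ∀ x : F, ((x : ℝ) : ℂ) ∈ K := by
    have hle : F ≤ K.comap (Complex.ofRealAm.restrictScalars ℚ) := by
      rw [hF, IntermediateField.adjoin_simple_le_iff]
      exact hcosK
    exact fun x ↦ hle x.2
  let f : F × F →ₗ[ℚ] K :=
    { toFun := fun p ↦ ⟨((p.1 : ℝ) : ℂ) + ((p.2 : ℝ) : ℂ) * (Real.sin θ * Complex.I),
        K.add_mem (hFK _) (K.mul_mem (hFK _) hsinK)⟩
      map_add' := fun p q ↦ by
        ext
        simp
        ring
      map_smul' := fun r p ↦ by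
        ext
        simp [Algebra.smul_def]
        ring }
  have hf : Function.Injective f := by
    rintro ⟨x, y⟩ ⟨x', y'⟩ h
    have h' := congrArg (Subtype.val) h
    simp only [f, LinearMap.coe_mk, AddHom.coe_mk] at h'
    have hre := congrArg Complex.re h'
    have him := congrArg Complex.im h'
    simp [-Complex.ofReal_sin, hsin] at hre him
    rw [hre, him]
  have hfinF : FiniteDimensional ℚ F :=
    .of_injective (f ∘ₗ LinearMap.inl ℚ F F) (hf.comp LinearMap.inl_injective)
  refine ⟨hfinF, ?_⟩
  have := LinearMap.finrank_le_finrank_of_injective hf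
  rw [Module.finrank_prod, hKrank] at this
  omega

lemma totient_le_two_mul_card {N : ℕ} (hN : 3 ≤ N) :
    N.totient ≤ 2 * (Finset.filter (fun k => 1 ≤ k ∧ 2 * k < N ∧ Nat.gcd k N = 1)
      (Finset.range N)).card := by
  set s := Finset.filter (fun k => 1 ≤ k ∧ 2 * k < N ∧ Nat.gcd k N = 1) (Finset.range N) with hs
  have hsub : Finset.filter (fun k ↦ N.Coprime k) (Finset.range N) ⊆ s ∪ s.image (N - ·) := by
    intro k hk
    simp only [Finset.mem_filter, Finset.mem_range] at hk
    obtain ⟨hkN, hco⟩ := hk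
    have hk0 : k ≠ 0 := by
      rintro rfl
      rw [Nat.coprime_zero_right] at hco
      omega
    have h2 : 2 * k ≠ N := by
      intro h
      have : k ∣ Nat.gcd N k := Nat.dvd_gcd ⟨2, by omega⟩ dvd_rfl
      rw [hco, Nat.dvd_one] at this
      omega
    simp only [hs, Finset.mem_union, Finset.mem_image, Finset.mem_filter, Finset.mem_range]
    rcases lt_or_gt_of_ne h2 with h | h
    · exact .inl ⟨hkN, by omega, h, hco.symm⟩
    · refine .inr ⟨N - k, ⟨by omega, by omega, by omega, ?_⟩, by omega⟩
      exact (Nat.coprime_self_sub_left hkN.le).2 hco.symm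
  calc N.totient = (Finset.filter (fun k ↦ N.Coprime k) (Finset.range N)).card := rfl
    _ ≤ (s ∪ s.image (N - ·)).card := Finset.card_le_card hsub
    _ ≤ s.card + (s.image (N - ·)).card := Finset.card_union_le _ _
    _ ≤ s.card + s.card := Nat.add_le_add_left Finset.card_image_le _
    _ = 2 * s.card := by ring

/-- For `N ≥ 3`, every scale `tan(π/N)/tan(kπ/N)` (`1 ≤ k < N/2`) lies in the
subfield `ℚ(cos(2π/N))` of `ℝ`, and the primitive scales (those with
`gcd(k, N) = 1`) form a `ℚ`-vector-space basis of `ℚ(cos(2π/N))`: they are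
linearly independent and their `ℚ`-span is the whole field. -/
theorem primitive_scales_basis_of_maximal_real_subfield
    (N : ℕ) (hN : 3 ≤ N) :
    (∀ k : ℕ, 1 ≤ k → 2 * k < N →
      Real.tan (Real.pi / N) / Real.tan (k * Real.pi / N) ∈
        IntermediateField.adjoin ℚ {Real.cos (2 * Real.pi / N)}) ∧
    (∀ a : ℕ → ℚ,
      (∑ k ∈ Finset.filter (fun k => 1 ≤ k ∧ 2 * k < N ∧ Nat.gcd k N = 1) (Finset.range N),
          (a k : ℝ) * (Real.tan (Real.pi / N) / Real.tan (k * Real.pi / N)) = 0) →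
        ∀ k : ℕ, 1 ≤ k → 2 * k < N → Nat.gcd k N = 1 → a k = 0) ∧
    Submodule.span ℚ
        {x : ℝ | ∃ k : ℕ, 1 ≤ k ∧ 2 * k < N ∧ Nat.gcd k N = 1 ∧
          x = Real.tan (Real.pi / N) / Real.tan (k * Real.pi / N)} =
      Subalgebra.toSubmodule
        (IntermediateField.adjoin ℚ {Real.cos (2 * Real.pi / N)}).toSubalgebra := by
  have hmem : ∀ k : ℕ, 1 ≤ k → 2 * k < N →
      Real.tan (Real.pi / N) / Real.tan (k * Real.pi / N) ∈
        IntermediateField.adjoin ℚ {Real.cos (2 * Real.pi / N)} := fun k _ hk ↦ by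
    rw [← inv_div (Real.tan (k * Real.pi / N))]
    exact IntermediateField.inv_mem _ (tan_div_tan_mem hN hk)
  have hN0 : NeZero N := ⟨by omega⟩
  have htan : Real.tan (Real.pi / N) ≠ 0 := by
    have hcos := cos_pos_of_two_mul_lt (N := N) (k := 1) (by omega)
    have hsin := sin_pos_of_two_mul_lt (N := N) (k := 1) le_rfl (by omega)
    rw [Nat.cast_one, one_mul] at hcos hsin
    rw [Real.tan_eq_sin_div_cos]
    positivity
  have hind : ∀ a : ℕ → ℚ,
      (∑ k ∈ Finset.filter (fun k => 1 ≤ k ∧ 2 * k < N ∧ Nat.gcd k N = 1) (Finset.range N),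
          (a k : ℝ) * (Real.tan (Real.pi / N) / Real.tan (k * Real.pi / N)) = 0) →
        ∀ k : ℕ, 1 ≤ k → 2 * k < N → Nat.gcd k N = 1 → a k = 0 := by
    intro a ha k hk₁ hk₂ hk₃
    refine coeff_eq_zero_of_sum_mul_cot_eq_zero (N := N) (by omega) (fun k hk ↦ ?_) ?_
      (l := k) (s := Finset.filter (fun k => 1 ≤ k ∧ 2 * k < N ∧ Nat.gcd k N = 1) (Finset.range N))
      (Finset.mem_filter.2 ⟨Finset.mem_range.2 (by omega), hk₁, hk₂, hk₃⟩)
    · exact (Finset.mem_filter.1 hk).2.2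
    · have hterm : ∀ k : ℕ, (a k : ℝ) * (Real.tan (Real.pi / N) / Real.tan (k * Real.pi / N)) =
          Real.tan (Real.pi / N) * ((a k : ℝ) * Real.cot (Real.pi * (k / N))) := by
        intro k
        rw [show (k : ℝ) * Real.pi / N = Real.pi * (k / N) by ring,
          ← Real.cot_inv_eq_tan (Real.pi * (k / N))]
        field_simp
      simp_rw [hterm, ← Finset.mul_sum] at ha
      have := (mul_eq_zero.1 ha).resolve_left htan
      have := congrArg Complex.ofReal this
      push_cast at this
      exact this
  refine ⟨hmem, hind, ?_⟩
  obtain ⟨hfin, hrank⟩ := two_mul_finrank_adjoin_cos_le hN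
  have hcard := totient_le_two_mul_card hN
  set F := IntermediateField.adjoin ℚ {Real.cos (2 * Real.pi / N)}
  set s := Finset.filter (fun k => 1 ≤ k ∧ 2 * k < N ∧ Nat.gcd k N = 1) (Finset.range N) with hs
  have hmem_s : ∀ k, k ∈ s ↔ 1 ≤ k ∧ 2 * k < N ∧ Nat.gcd k N = 1 := fun k ↦ by
    simp only [hs, Finset.mem_filter, Finset.mem_range, and_iff_right_iff_imp]
    omega
  let v : s → ℝ := fun k ↦ Real.tan (Real.pi / N) / Real.tan ((k : ℕ) * Real.pi / N)
  have hrange : {x : ℝ | ∃ k : ℕ, 1 ≤ k ∧ 2 * k < N ∧ Nat.gcd k N = 1 ∧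
      x = Real.tan (Real.pi / N) / Real.tan (k * Real.pi / N)} = Set.range v := by
    ext x
    constructor
    · rintro ⟨k, h₁, h₂, h₃, rfl⟩
      exact ⟨⟨k, (hmem_s k).2 ⟨h₁, h₂, h₃⟩⟩, rfl⟩
    · rintro ⟨⟨k, hk⟩, rfl⟩
      obtain ⟨h₁, h₂, h₃⟩ := (hmem_s k).1 hk
      exact ⟨k, h₁, h₂, h₃, rfl⟩
  have hli : LinearIndependent ℚ v := by
    rw [Fintype.linearIndependent_iff]
    intro g hg i
    have := hind (fun k ↦ if h : k ∈ s then g ⟨k, h⟩ else 0) ?_ i ((hmem_s i).1 i.2).1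
      ((hmem_s i).1 i.2).2.1 ((hmem_s i).1 i.2).2.2
    · simpa using this
    · rw [← hg, ← Finset.sum_coe_sort]
      refine Finset.sum_congr rfl fun k _ ↦ ?_
      simp [v, Algebra.smul_def]
  rw [hrange]
  have : FiniteDimensional ℚ (Subalgebra.toSubmodule F.toSubalgebra) := hfin
  refine Submodule.eq_of_le_of_finrank_le ?_ ?_
  · rw [Submodule.span_le]
    rintro _ ⟨k, rfl⟩
    exact hmem k ((hmem_s k).1 k.2).1 ((hmem_s k).1 k.2).2.1
  · rw [finrank_span_eq_card hli, Fintype.card_coe]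
    change Module.finrank ℚ F ≤ _
    omega
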